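/- Suppose S is smooth and let 1 ≤ i ≤ n−p. Then the incidence variety 𝓗_i is nonempty, smooth, and equidimensional of dimension n−p−i+(n−p−i+1)n. -/

import Mathlib

open MvPolynomial

noncomputable section

/-- The Zariski closure of a subset of the affine space `σ → ℂ`. -/
def zcl {σ : Type} (T : Set (σ → ℂ)) : Set (σ → ℂ) :=
  MvPolynomial.zeroLocus ℂ (MvPolynomial.vanishingIdeal ℂ T)

/-- Zariski open subsets of the affine space `σ → ℂ`. -/
def ZOpen {σ : Type} (U : Set (σ → ℂ)) : Prop :=
  ∃ I : Ideal (MvPolynomial σ ℂ), U = {x | ∃ f ∈ I, MvPolynomial.eval x f ≠ 0}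

/-- Zariski open subsets of the space of `m × n` complex matrices. -/
def ZOpenMat {m n : ℕ} (U : Set (Matrix (Fin m) (Fin n) ℂ)) : Prop :=
  ∃ I : Ideal (MvPolynomial (Fin m × Fin n) ℂ),
    U = {a | ∃ f ∈ I, MvPolynomial.eval (fun q => a q.1 q.2) f ≠ 0}

/-- `T` is of pure dimension `d`: every irreducible component of (the Zariski closure of) `T`,
i.e. every minimal prime over its vanishing ideal, has coordinate ring of Krull dimension `d`. -/
def IsPureDim {σ : Type} (T : Set (σ → ℂ)) (d : ℕ) : Prop :=
  ∀ P ∈ (MvPolynomial.vanishingIdeal ℂ T).minimalPrimes,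
    ringKrullDim (MvPolynomial σ ℂ ⧸ P) = (d : WithBot (WithTop ℕ))

/-- The Zariski tangent space at a point `x` of (the Zariski closure of) a subset `T`
of affine space: the common kernel of the differentials at `x` of all polynomials
vanishing on `T`. -/
def tangentAt {σ : Type} [Fintype σ] [DecidableEq σ] (T : Set (σ → ℂ)) (x : σ → ℂ) :
    Submodule ℂ (σ → ℂ) :=
  ⨅ (f : MvPolynomial σ ℂ) (_ : f ∈ MvPolynomial.vanishingIdeal ℂ T),
    LinearMap.ker
      (∑ l, MvPolynomial.eval x (MvPolynomial.pderiv l f) •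
        (LinearMap.proj l : (σ → ℂ) →ₗ[ℂ] ℂ))

/-- `rs` is a regular sequence in the commutative ring `R`. -/
def IsRegSeq {R : Type*} [CommRing R] (rs : List R) : Prop :=
  Ideal.span {x | x ∈ rs} ≠ ⊤ ∧
  ∀ j, j < rs.length → ∀ b : R,
    rs.getD j 0 * b ∈ Ideal.span {x | x ∈ rs.take j} →
    b ∈ Ideal.span {x | x ∈ rs.take j}

/-- The common zero set in `ℂⁿ` of polynomials `F₁, …, F_p ∈ ℚ[X₁, …, Xₙ]`. -/
def zeroSetC {n p : ℕ} (F : Fin p → MvPolynomial (Fin n) ℚ) : Set (Fin n → ℂ) :=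
  {x | ∀ k, MvPolynomial.aeval x (F k) = 0}

/-- The Jacobian matrix `[∂F_k/∂X_l]` evaluated at `x ∈ ℂⁿ`. -/
def jacC {n p : ℕ} (F : Fin p → MvPolynomial (Fin n) ℚ) (x : Fin n → ℂ) :
    Matrix (Fin p) (Fin n) ℂ :=
  Matrix.of fun k l => MvPolynomial.aeval x (MvPolynomial.pderiv l (F k))

/-- The set of regular points of `S = {F₁ = 0, …, F_p = 0}`: points of `S` where the
Jacobian has maximal rank `p`. -/
def SregC {n p : ℕ} (F : Fin p → MvPolynomial (Fin n) ℚ) : Set (Fin n → ℂ) :=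
  {x | x ∈ zeroSetC F ∧ (jacC F x).rank = p}

/-- The classic polar variety: the Zariski closure of the locus of regular points of `S`
where the matrix obtained by appending the rows of `a` to the Jacobian has rank at
most `r` (i.e. where all `(r+1)`-minors vanish). -/
def Wclassic {n p m : ℕ} (F : Fin p → MvPolynomial (Fin n) ℚ)
    (a : Matrix (Fin m) (Fin n) ℂ) (r : ℕ) : Set (Fin n → ℂ) :=
  zcl {x | x ∈ SregC F ∧ (Matrix.fromRows (jacC F x) a).rank ≤ r}

/-- The dual polar variety: as `Wclassic`, with appended rows `(a_{k,1} - X₁, …, a_{k,n} - Xₙ)`. -/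
def Wdual {n p m : ℕ} (F : Fin p → MvPolynomial (Fin n) ℚ)
    (a : Matrix (Fin m) (Fin n) ℂ) (r : ℕ) : Set (Fin n → ℂ) :=
  zcl {x | x ∈ SregC F ∧
    (Matrix.fromRows (jacC F x) (Matrix.of fun k l => a k l - x l)).rank ≤ r}

/-- `F₁, …, F_p` generate the full vanishing ideal of their zero set (over `ℂ`);
this encodes that `(F₁, …, F_p)` is reduced (radical) and the ideal of definition of `S`. -/
def idealOfDef {n p : ℕ} (F : Fin p → MvPolynomial (Fin n) ℚ) : Prop :=
  MvPolynomial.vanishingIdeal ℂ (zeroSetC F) =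
    Ideal.span (Set.range fun k => MvPolynomial.map (algebraMap ℚ ℂ) (F k))

/-- The submatrix of the first `m` rows of a matrix. -/
def firstRows {N n' m : ℕ} (a : Matrix (Fin N) (Fin n') ℂ) (h : m ≤ N) :
    Matrix (Fin m) (Fin n') ℂ :=
  Matrix.of fun k l => a (Fin.castLE h k) l

/-- The matrix obtained by deleting row `h`. -/
def rowErase {m n' : ℕ} (a : Matrix (Fin (m + 1)) (Fin n') ℂ) (h : Fin (m + 1)) :
    Matrix (Fin m) (Fin n') ℂ :=
  Matrix.of fun k l => a (h.succAbove k) l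

/-- The real trace `S_ℝ := S ∩ ℝⁿ`, as a subset of Euclidean space. -/
def SR {n p : ℕ} (F : Fin p → MvPolynomial (Fin n) ℚ) : Set (EuclideanSpace ℝ (Fin n)) :=
  {x | (fun j => (x j : ℂ)) ∈ zeroSetC F}

/-- `C` is a connected component of `T`. -/
def IsConnCompOf {α : Type*} [TopologicalSpace α] (C T : Set α) : Prop :=
  C.Nonempty ∧ C ⊆ T ∧ IsPreconnected C ∧
    ∀ D, C ⊆ D → D ⊆ T → IsPreconnected D → D = C

end

/-- The affine cone over the incidence variety `𝓗_i`: points are triples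
`(x, a, (λ, θ))` (flattened into a single function) with `x ∈ S_reg`,
`a` an `m × n` matrix of maximal rank `m = n-p-i+1`, `(λ, θ) ≠ 0` and
`J(F)(x)ᵀ·λᵀ + aᵀ·θᵀ = 0`.  The projectivization of its last factor is `𝓗_i`. -/
def Hcone {n p : ℕ} (F : Fin p → MvPolynomial (Fin n) ℚ) (m : ℕ) :
    Set (((Fin n ⊕ (Fin m × Fin n)) ⊕ (Fin p ⊕ Fin m)) → ℂ) :=
  {q | (fun l => q (Sum.inl (Sum.inl l))) ∈ SregC F ∧
    (Matrix.of fun k l => q (Sum.inl (Sum.inr (k, l))) : Matrix (Fin m) (Fin n) ℂ).rank = m ∧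
    (fun s => q (Sum.inr s)) ≠ (0 : Fin p ⊕ Fin m → ℂ) ∧
    Matrix.vecMul (fun s => q (Sum.inr s))
      (Matrix.fromRows (jacC F fun l => q (Sum.inl (Sum.inl l)))
        (Matrix.of fun k l => q (Sum.inl (Sum.inr (k, l))))) = 0}

section KrullDimension

variable {A B : Type*} [CommRing A] [CommRing B] [Algebra A B]

theorem ringKrullDim_eq_of_isIntegral_of_injective [Algebra.IsIntegral A B]
    (hinj : Function.Injective (algebraMap A B)) : ringKrullDim B = ringKrullDim A := by
  apply le_antisymm
  · refine Order.krullDim_le_of_strictMono (PrimeSpectrum.comap (algebraMap A B)) ?_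
    intro P Q hPQ
    exact Ideal.IsIntegral.comap_lt_comap (R := A) (I := P.asIdeal) (J := Q.asIdeal) hPQ
  · refine iSup_le fun l => ?_
    obtain ⟨Q, -, hQ, hQl⟩ := Ideal.exists_ideal_over_prime_of_isIntegral
      (RelSeries.head l).asIdeal (⊥ : Ideal B) (by
        rw [← RingHom.ker_eq_comap_bot, (RingHom.injective_iff_ker_eq_bot _).mp hinj]
        exact bot_le)
    have : Q.LiesOver (RelSeries.head l).asIdeal := ⟨hQl.symm⟩
    obtain ⟨L, hL, -⟩ := Ideal.exists_ltSeries_of_hasGoingUp l Q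
    rw [← hL]
    exact le_iSup (fun l : LTSeries (PrimeSpectrum B) => (l.length : WithBot ℕ∞)) L

end KrullDimension

/-- The Krull dimension of a domain of finite type over a field is its transcendence degree. -/
theorem exists_ringKrullDim_eq_and_trdeg_eq (k A : Type*) [Field k] [CommRing A] [IsDomain A]
    [Algebra k A] [Algebra.FiniteType k A] :
    ∃ s : ℕ, ringKrullDim A = s ∧ Algebra.trdeg k A = s := by
  obtain ⟨s, g, hg, hgint⟩ := exists_integral_inj_algHom_of_fg k A
  refine ⟨s, ?_, ?_⟩
  · algebraize [g.toRingHom]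
    rw [ringKrullDim_eq_of_isIntegral_of_injective (A := MvPolynomial (Fin s) k) hg]
    simp
  · have hx : AlgebraicIndependent k fun j => g (X j) := by
      rw [AlgebraicIndependent]
      convert! hg
      ext; simp
    have hrange : Algebra.adjoin k (Set.range fun j => g (X j)) = g.range := by
      rw [show (Set.range fun j => g (X j)) = g '' Set.range X by
          rw [← Set.range_comp]; rfl, ← AlgHom.map_adjoin, MvPolynomial.adjoin_range_X,
        Algebra.map_top]
    have halg : Algebra.IsAlgebraic (Algebra.adjoin k (Set.range fun j => g (X j))) A := by
      rw [hrange]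
      refine ⟨fun a => IsIntegral.isAlgebraic ?_⟩
      obtain ⟨f, hf, hfa⟩ := hgint a
      refine ⟨f.map g.rangeRestrict.toRingHom, hf.map _, ?_⟩
      rw [Polynomial.eval₂_map]
      exact hfa
    have hb := (hx.isTranscendenceBasis_iff_isAlgebraic).mpr halg
    have := hb.lift_cardinalMk_eq_trdeg
    simpa using this.symm

section AffineSpace

variable {σ : Type*}

theorem height_vanishingIdeal_singleton_eq {k : Type*} [Field k] (x y : σ → k) :
    (vanishingIdeal k {x}).height = (vanishingIdeal k {y}).height := by
  let e : MvPolynomial σ k ≃ₐ[k] MvPolynomial σ k :=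
    AlgEquiv.ofAlgHom (aeval fun j => X j + C (x j - y j)) (aeval fun j => X j + C (y j - x j))
      (by ext1 j; simp [algebraMap_eq]; ring) (by ext1 j; simp [algebraMap_eq]; ring)
  rw [← RingEquiv.height_comap e.toRingEquiv (vanishingIdeal k {y})]
  congr 1
  ext f
  rw [mem_vanishingIdeal_singleton_iff, Ideal.mem_comap, mem_vanishingIdeal_singleton_iff]
  have : (aeval y : MvPolynomial σ k →ₐ[k] k).comp e.toAlgHom = aeval x := by
    ext j; simp [e]
  rw [← this]; rfl

theorem height_vanishingIdeal_singleton [Finite σ] {k : Type*} [Field k] [IsAlgClosed k]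
    (x : σ → k) :
    (vanishingIdeal k {x}).height = Nat.card σ := by
  have h := Ideal.sup_isMaximal_height_eq_ringKrullDim (R := MvPolynomial σ k)
  rw [MvPolynomial.ringKrullDim_of_isNoetherianRing, ringKrullDim_eq_zero_of_field,
    zero_add] at h
  have h' : (⨆ (I : Ideal (MvPolynomial σ k)) (_ : I.IsMaximal), I.height) = Nat.card σ := by
    exact_mod_cast h
  rw [← h']
  apply le_antisymm
  · exact le_iSup₂ (f := fun (I : Ideal (MvPolynomial σ k)) (_ : I.IsMaximal) => I.height)
      (vanishingIdeal k {x}) inferInstance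
  · refine iSup₂_le fun I hI => ?_
    obtain ⟨y, rfl⟩ := isMaximal_iff_eq_vanishingIdeal_singleton.mp hI
    exact (height_vanishingIdeal_singleton_eq y x).le

end AffineSpace

section LocallyCutOut

variable {σ ι : Type*} [Finite σ] [Finite ι] {k : Type*} [Field k]

/-- `G` cuts out `T` in the principal open neighbourhood of `q` given by some polynomial. -/
def CutsOutAt (T : Set (σ → k)) (G : ι → MvPolynomial σ k) (q : σ → k) : Prop :=
  ∃ d : MvPolynomial σ k, aeval q d ≠ 0 ∧
    ∀ x, (∀ j, aeval x (G j) = 0) → aeval x d ≠ 0 → x ∈ T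

theorem exists_mem_zeroLocus_of_mem_minimalPrimes {T : Set (σ → k)} {P : Ideal (MvPolynomial σ k)}
    (hP : P ∈ (vanishingIdeal k T).minimalPrimes) :
    ∃ q ∈ T, q ∈ zeroLocus k P ∧ ∃ g : MvPolynomial σ k, aeval q g ≠ 0 ∧
      ∀ f ∈ P, f * g ∈ vanishingIdeal k T := by
  classical
  have hPprime : P.IsPrime := hP.1.1
  have hfin := Ideal.finite_minimalPrimes_of_isNoetherianRing _ (vanishingIdeal k T)
  have hnot : ¬ (∏ Q ∈ hfin.toFinset.erase P, Q) ≤ P := by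
    rw [Ideal.IsPrime.prod_le hPprime]
    rintro ⟨Q, hQ, hQP⟩
    rw [Finset.mem_erase, Set.Finite.mem_toFinset] at hQ
    exact hQ.1 (le_antisymm hQP (hP.2 hQ.2.1 hQP))
  obtain ⟨g, hg, hgP⟩ := Set.not_subset.mp hnot
  have hrad : (vanishingIdeal k T).radical = vanishingIdeal k T := by
    refine le_antisymm (fun f hf x hx => ?_) Ideal.le_radical
    obtain ⟨N, hN⟩ := hf
    have := hN x hx
    rw [map_pow] at this
    exact eq_zero_of_pow_eq_zero this
  have hmul : ∀ f ∈ P, f * g ∈ vanishingIdeal k T := by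
    intro f hf
    rw [← hrad, ← Ideal.sInf_minimalPrimes, Submodule.mem_sInf]
    intro Q hQ
    by_cases hQP : Q = P
    · subst hQP; exact Ideal.mul_mem_right _ Q hf
    · exact Ideal.mul_mem_left Q _ (Ideal.prod_le_inf.trans
        (Finset.inf_le (f := id) (by simp [hQP, hQ])) hg)
  have hgT : g ∉ vanishingIdeal k T := fun h => hgP (hP.1.2 h)
  rw [mem_vanishingIdeal_iff] at hgT
  push Not at hgT
  obtain ⟨q, hqT, hq⟩ := hgT
  refine ⟨q, hqT, fun f hf => ?_, g, hq, hmul⟩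
  have := hmul f hf q hqT
  rw [map_mul] at this
  exact (mul_eq_zero.mp this).resolve_right hq

theorem card_le_ringKrullDim_add_card [IsAlgClosed k] {T : Set (σ → k)} {G : ι → MvPolynomial σ k}
    (hG : ∀ x ∈ T, ∀ j, aeval x (G j) = 0) (hT : ∀ q ∈ T, CutsOutAt T G q)
    {P : Ideal (MvPolynomial σ k)} (hP : P ∈ (vanishingIdeal k T).minimalPrimes) :
    (Nat.card σ : WithBot ℕ∞) ≤ ringKrullDim (MvPolynomial σ k ⧸ P) + Nat.card ι := by
  classical
  have := Fintype.ofFinite ι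
  have hPprime : P.IsPrime := hP.1.1
  obtain ⟨q, hqT, hqP, g, hgq, hg⟩ := exists_mem_zeroLocus_of_mem_minimalPrimes hP
  obtain ⟨d, hdq, hd⟩ := hT q hqT
  set M := vanishingIdeal k {q} with hM
  have hPM : P ≤ M := fun f hf => by
    rw [hM, mem_vanishingIdeal_singleton_iff]; exact hqP f hf
  have hPQ : ∀ Q : Ideal (MvPolynomial σ k), Q.IsPrime → Set.range G ⊆ Q → Q ≤ M → P ≤ Q := by
    intro Q hQ hGQ hQM f hf
    have hfgd : f * g * d ∈ vanishingIdeal k (zeroLocus k (Ideal.span (Set.range G))) := by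
      intro x hx
      by_cases hdx : aeval x d = 0
      · rw [map_mul, hdx, mul_zero]
      · have hxT : x ∈ T := hd x (fun j => hx _ (Ideal.subset_span ⟨j, rfl⟩)) hdx
        rw [map_mul, hg f hf x hxT, zero_mul]
    rw [vanishingIdeal_zeroLocus_eq_radical] at hfgd
    have hfgdQ : f * g * d ∈ Q :=
      (hQ.isRadical.radical_le_iff.mpr (Ideal.span_le.mpr hGQ)) hfgd
    have hdQ : d ∉ Q := fun h => hdq ((mem_vanishingIdeal_singleton_iff q d).mp (hQM h))
    have hgQ : g ∉ Q := fun h => hgq ((mem_vanishingIdeal_singleton_iff q g).mp (hQM h))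
    exact (hQ.mem_or_mem ((hQ.mem_or_mem hfgdQ).resolve_right hdQ)).resolve_right hgQ
  have hMprime : M.IsPrime := inferInstanceAs (vanishingIdeal k {q}).IsPrime
  have hM' : (M.map (Ideal.Quotient.mk P)).IsPrime := Ideal.isPrime_map_quotientMk_of_isPrime hPM
  obtain ⟨s, hs, hscard⟩ :=
    Ideal.exists_finset_card_eq_height_of_isNoetherianRing (M.map (Ideal.Quotient.mk P))
  choose lift hlift using Ideal.Quotient.mk_surjective (I := P)
  let t : Finset (MvPolynomial σ k) := s.image lift ∪ Finset.univ.image G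
  have hcomapM : (M.map (Ideal.Quotient.mk P)).comap (Ideal.Quotient.mk P) = M := by
    rw [Ideal.comap_map_of_surjective _ Ideal.Quotient.mk_surjective,
      ← RingHom.ker_eq_comap_bot, Ideal.mk_ker, sup_eq_left.mpr hPM]
  have ht : M ∈ (Ideal.span (t : Set (MvPolynomial σ k))).minimalPrimes := by
    refine ⟨⟨hMprime, ?_⟩, ?_⟩
    · rw [Ideal.span_le]
      intro f hf
      simp only [t, Finset.coe_union, Finset.coe_image, Finset.coe_univ, Set.image_univ] at hf
      rcases hf with ⟨a, ha, rfl⟩ | ⟨j, rfl⟩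
      · rw [← hcomapM, SetLike.mem_coe, Ideal.mem_comap, hlift]
        exact hs.1.2 (Ideal.subset_span ha)
      · exact (mem_vanishingIdeal_singleton_iff q _).mpr (hG q hqT j)
    · rintro Q ⟨hQ, htQ⟩ hQM
      rw [Ideal.span_le] at htQ
      have hPQ' : P ≤ Q := hPQ Q hQ
        (fun f hf => htQ (by simpa [t] using Or.inr hf)) hQM
      have hQ' := Ideal.isPrime_map_quotientMk_of_isPrime hPQ'
      have hle : M.map (Ideal.Quotient.mk P) ≤ Q.map (Ideal.Quotient.mk P) := by
        refine hs.2 ⟨hQ', ?_⟩ (Ideal.map_mono hQM)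
        rw [Ideal.span_le]
        intro a ha
        rw [← hlift a]
        exact Ideal.mem_map_of_mem _ (htQ (by
          simp only [t, Finset.coe_union, Finset.coe_image]
          exact Or.inl ⟨a, ha, rfl⟩))
      rw [← hcomapM]
      refine (Ideal.comap_mono hle).trans ?_
      rw [Ideal.comap_map_of_surjective _ Ideal.Quotient.mk_surjective,
        ← RingHom.ker_eq_comap_bot, Ideal.mk_ker, sup_eq_left.mpr hPQ']
  have hcard : t.card ≤ s.card + Nat.card ι := by
    refine (Finset.card_union_le _ _).trans (add_le_add Finset.card_image_le ?_)
    rw [Nat.card_eq_fintype_card]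
    exact Finset.card_image_le
  have hheight := Ideal.height_le_card_of_mem_minimalPrimes_span_finset ht
  rw [hM, height_vanishingIdeal_singleton] at hheight
  have hσ : Nat.card σ ≤ s.card + Nat.card ι := by
    have : Nat.card σ ≤ t.card := by exact_mod_cast hheight
    lia
  have hsdim : (s.card : WithBot ℕ∞) ≤ ringKrullDim (MvPolynomial σ k ⧸ P) := by
    refine le_trans ?_ (Ideal.height_le_ringKrullDim_of_ne_top hM'.ne_top)
    rw [← hscard]; rfl
  calc (Nat.card σ : WithBot ℕ∞) ≤ (s.card : WithBot ℕ∞) + Nat.card ι := by exact_mod_cast hσ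
    _ ≤ _ := by gcongr

end LocallyCutOut

/-- If every variable is, modulo `P`, a quotient of polynomials in the variables from
`Set.range ρ ∪ S`, then eliminating the variables outside `Set.range ρ` lowers the dimension of
`P` by at most the cardinality of `S`. -/
theorem ringKrullDim_quotient_le_comap_rename_add_card {σ τ k : Type} [Field k] [Finite σ]
    [Finite τ] (P : Ideal (MvPolynomial σ k)) [P.IsPrime] (ρ : τ → σ) (S : Finset σ)
    (hS : ∀ j, ∃ h ∈ supported k (Set.range ρ ∪ (S : Set σ)), h ∉ P ∧
      ∃ f ∈ supported k (Set.range ρ ∪ (S : Set σ)), h * X j - f ∈ P) :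
    ringKrullDim (MvPolynomial σ k ⧸ P) ≤
      ringKrullDim (MvPolynomial τ k ⧸ P.comap (rename (R := k) ρ)) + S.card := by
  classical
  let π : MvPolynomial σ k →ₐ[k] MvPolynomial σ k ⧸ P := Ideal.Quotient.mkₐ k P
  let A₀ : Subalgebra k (MvPolynomial σ k ⧸ P) := (π.comp (rename ρ)).range
  let s : Finset (MvPolynomial σ k ⧸ P) := S.image fun j => π (X j)
  have hdim : ringKrullDim A₀ = ringKrullDim (MvPolynomial τ k ⧸ P.comap (rename (R := k) ρ)) := by
    have hker : RingHom.ker (π.comp (rename ρ)).rangeRestrict = P.comap (rename (R := k) ρ) := by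
      ext f
      rw [RingHom.mem_ker, Ideal.mem_comap, ← Ideal.Quotient.eq_zero_iff_mem, Subtype.ext_iff]
      rfl
    rw [← hker]
    exact (ringKrullDim_eq_of_ringEquiv (RingHom.quotientKerEquivOfSurjective
      (f := ((π.comp (rename ρ)).rangeRestrict : MvPolynomial τ k →+* A₀))
      (π.comp (rename ρ)).rangeRestrict_surjective)).symm
  have hsupp : ∀ f ∈ supported k (Set.range ρ ∪ (S : Set σ)),
      π f ∈ Algebra.adjoin A₀ (s : Set (MvPolynomial σ k ⧸ P)) := by
    intro f hf
    have : supported k (Set.range ρ ∪ (S : Set σ)) ≤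
        ((Algebra.adjoin A₀ (s : Set (MvPolynomial σ k ⧸ P))).restrictScalars k).comap π := by
      refine Algebra.adjoin_le ?_
      rintro _ ⟨j, ⟨l, rfl⟩ | hj, rfl⟩
      · have : π (X (ρ l)) ∈ A₀ := ⟨X l, by simp⟩
        exact Subalgebra.algebraMap_mem
          (Algebra.adjoin A₀ (s : Set (MvPolynomial σ k ⧸ P))) ⟨_, this⟩
      · exact Algebra.subset_adjoin (Finset.mem_coe.mpr (Finset.mem_image_of_mem _ hj))
    exact this hf
  have halg : Algebra.IsAlgebraic (Algebra.adjoin A₀ (s : Set (MvPolynomial σ k ⧸ P)))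
      (MvPolynomial σ k ⧸ P) := by
    refine ⟨fun a => ?_⟩
    obtain ⟨f, rfl⟩ := Ideal.Quotient.mkₐ_surjective k P a
    change IsAlgebraic _ (π f)
    induction f using MvPolynomial.induction_on with
    | C c =>
      have := hsupp (C c) (Subalgebra.algebraMap_mem _ c)
      exact isAlgebraic_algebraMap
        (⟨_, this⟩ : Algebra.adjoin A₀ (s : Set (MvPolynomial σ k ⧸ P)))
    | add f g hf hg => rw [map_add]; exact hf.add hg
    | mul_X f j hf =>
      rw [map_mul]
      refine hf.mul ?_
      obtain ⟨h, hh, hhP, f, hf, hfP⟩ := hS j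
      have halg' : ∀ g ∈ supported k (Set.range ρ ∪ (S : Set σ)), IsAlgebraic
          (Algebra.adjoin A₀ (s : Set (MvPolynomial σ k ⧸ P))) (π g) := fun g hg =>
        isAlgebraic_algebraMap
          (⟨_, hsupp g hg⟩ : Algebra.adjoin A₀ (s : Set (MvPolynomial σ k ⧸ P)))
      have hπh : π h ∈ nonZeroDivisors (MvPolynomial σ k ⧸ P) :=
        mem_nonZeroDivisors_of_ne_zero fun h0 => hhP (Ideal.Quotient.eq_zero_iff_mem.mp h0)
      refine IsAlgebraic.of_mul hπh (halg' h hh) ?_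
      have : π h * π (X j) = π f := by
        rw [← map_mul]
        exact (Ideal.Quotient.mk_eq_mk_iff_sub_mem _ _).mpr hfP
      rw [this]
      exact halg' f hf
  have : Algebra.FiniteType k A₀ :=
    Algebra.FiniteType.of_surjective (π.comp (rename ρ)).rangeRestrict
      (π.comp (rename ρ)).rangeRestrict_surjective
  obtain ⟨a, ha, ha'⟩ := exists_ringKrullDim_eq_and_trdeg_eq k (MvPolynomial σ k ⧸ P)
  obtain ⟨b, hb, hb'⟩ := exists_ringKrullDim_eq_and_trdeg_eq k A₀
  have hle : Algebra.trdeg A₀ (MvPolynomial σ k ⧸ P) ≤ S.card := by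
    refine (Algebra.IsAlgebraic.trdeg_le_cardinalMk A₀ (s : Set (MvPolynomial σ k ⧸ P))).trans ?_
    refine (Cardinal.mk_coe_finset (s := s)).le.trans ?_
    exact_mod_cast Finset.card_image_le
  have : FaithfulSMul k A₀ :=
    (faithfulSMul_iff_algebraMap_injective k A₀).mpr (algebraMap k A₀).injective
  have hadd := trdeg_add_eq k A₀ (A := MvPolynomial σ k ⧸ P)
  rw [ha', hb'] at hadd
  have hab : (a : Cardinal) ≤ b + S.card := by rw [← hadd]; gcongr
  rw [← hdim, ha, hb]
  exact_mod_cast hab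

theorem MvPolynomial.hasStrictFDerivAt_eval {σ : Type*} [Fintype σ] (f : MvPolynomial σ ℂ)
    (x : σ → ℂ) :
    HasStrictFDerivAt (fun y => eval y f)
      (∑ l, eval x (pderiv l f) • (ContinuousLinearMap.proj l : (σ → ℂ) →L[ℂ] ℂ)) x := by
  classical
  induction f using MvPolynomial.induction_on with
  | C c =>
    simp only [eval_C]
    refine (hasStrictFDerivAt_const (𝕜 := ℂ) c x).congr_fderiv ?_
    ext v
    simp
  | add f g hf hg =>
    simp only [map_add]
    refine (hf.add hg).congr_fderiv ?_
    ext v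
    simp [add_mul, Finset.sum_add_distrib]
  | mul_X f j hf =>
    have hX : HasStrictFDerivAt (fun y : σ → ℂ => y j) (ContinuousLinearMap.proj j) x :=
      (ContinuousLinearMap.proj (R := ℂ) (φ := fun _ : σ => ℂ) j).hasStrictFDerivAt
    simp only [map_mul, eval_X]
    refine (hf.mul hX).congr_fderiv ?_
    ext v
    simp [add_mul, Finset.sum_add_distrib, Finset.mul_sum,
      Pi.single_apply, apply_ite, mul_assoc]

/-- The Jacobian matrix of a family of polynomials. -/
noncomputable def jacobianAt {σ ι : Type*} (G : ι → MvPolynomial σ ℂ) (q : σ → ℂ) : Matrix ι σ ℂ :=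
  Matrix.of fun j l => eval q (pderiv l (G j))

theorem finrank_tangentAt_add_card {σ ι : Type} [Fintype σ] [DecidableEq σ] [Fintype ι]
    {T : Set (σ → ℂ)} {G : ι → MvPolynomial σ ℂ} (hG : ∀ x ∈ T, ∀ j, aeval x (G j) = 0)
    {q : σ → ℂ} (hqT : q ∈ T) (hT : CutsOutAt T G q)
    (hJ : LinearIndependent ℂ (jacobianAt G q).row) :
    Module.finrank ℂ (tangentAt T q) + Fintype.card ι = Fintype.card σ := by
  classical
  let J := jacobianAt G q
  have hrank : J.rank = Fintype.card ι := hJ.rank_matrix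
  let f' : (σ → ℂ) →L[ℂ] (ι → ℂ) := ContinuousLinearMap.pi fun j =>
    ∑ l, eval q (pderiv l (G j)) • (ContinuousLinearMap.proj l : (σ → ℂ) →L[ℂ] ℂ)
  have hf'J : (f' : (σ → ℂ) →ₗ[ℂ] (ι → ℂ)) = J.mulVecLin := by
    refine LinearMap.ext fun v => funext fun j => ?_
    simp [f', J, jacobianAt, Matrix.mulVec, dotProduct]
  have hsurj : (f' : (σ → ℂ) →ₗ[ℂ] (ι → ℂ)).range = ⊤ := by
    refine Submodule.eq_top_of_finrank_eq ?_
    rw [hf'J, Module.finrank_fintype_fun_eq_card, ← hrank]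
    rfl
  have hstrict : HasStrictFDerivAt (fun y j => eval y (G j)) f' q :=
    hasStrictFDerivAt_pi.mpr fun j => hasStrictFDerivAt_eval (G j) q
  have hG0 : (fun j => eval q (G j)) = 0 := funext fun j => by simpa using hG q hqT j
  have hker : tangentAt T q = (f' : (σ → ℂ) →ₗ[ℂ] (ι → ℂ)).ker := by
    apply le_antisymm
    · intro v hv
      rw [tangentAt, Submodule.mem_iInf] at hv
      refine LinearMap.mem_ker.mpr (funext fun j => ?_)
      have h := hv (G j)
      rw [Submodule.mem_iInf] at h
      have h := h fun x hx => hG x hx j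
      simpa [f'] using h
    · intro v hv
      rw [tangentAt, Submodule.mem_iInf]
      intro f
      rw [Submodule.mem_iInf]
      intro hf
      obtain ⟨d, hdq, hd⟩ := hT
      set φ := hstrict.implicitFunction _ f' hsurj (fun j => eval q (G j)) with hφ
      have hφd : HasStrictFDerivAt φ f'.ker.subtypeL 0 := hstrict.to_implicitFunction hsurj
      have hφ0 : φ 0 = q := hstrict.implicitFunction_apply_image hsurj
      have hφG : ∀ᶠ w in nhds (0 : f'.ker), (fun j => eval (φ w) (G j)) = 0 := by
        have := hstrict.map_implicitFunction_eq hsurj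
        have h2 : Filter.Tendsto (fun w : f'.ker => ((fun j => eval q (G j)), w)) (nhds 0)
            (nhds ((fun j => eval q (G j)), 0)) :=
          (Continuous.prodMk_right _).tendsto 0
        filter_upwards [h2.eventually this] with w hw
        rw [← hG0]; exact hw
      have hφdne : ∀ᶠ w in nhds (0 : f'.ker), eval (φ w) d ≠ 0 := by
        have hc : ContinuousAt (fun w => eval (φ w) d) 0 := by
          have h1 : ContinuousAt (fun y => eval y d) (φ 0) := by
            rw [hφ0]; exact (hasStrictFDerivAt_eval d q).continuousAt
          exact ContinuousAt.comp (g := fun y => eval y d) (f := φ) h1 hφd.continuousAt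
        refine hc.eventually_ne ?_
        rw [hφ0]; simpa using hdq
      have hφf : (fun w => eval (φ w) f) =ᶠ[nhds 0] fun _ => 0 := by
        filter_upwards [hφG, hφdne] with w hw hwd
        have hwT : φ w ∈ T :=
          hd _ (fun j => by simpa using congrFun hw j) (by simpa using hwd)
        simpa using hf _ hwT
      have hcomp : HasFDerivAt (fun w => eval (φ w) f)
          ((∑ l, eval q (pderiv l f) • (ContinuousLinearMap.proj l : (σ → ℂ) →L[ℂ] ℂ)).comp
            f'.ker.subtypeL) 0 := by
        have h1 := (hasStrictFDerivAt_eval f q).hasFDerivAt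
        rw [← hφ0] at h1
        have := h1.comp (0 : f'.ker) hφd.hasFDerivAt
        rw [hφ0] at this
        exact this
      have hzero := hcomp.unique ((hasFDerivAt_const (0 : ℂ) (0 : f'.ker)).congr_of_eventuallyEq hφf)
      have := DFunLike.congr_fun hzero (⟨v, hv⟩ : f'.ker)
      rw [LinearMap.mem_ker]
      simpa using this
  have hrn := LinearMap.finrank_range_add_finrank_ker (f' : (σ → ℂ) →ₗ[ℂ] (ι → ℂ))
  rw [hsurj, finrank_top, Module.finrank_fintype_fun_eq_card,
    Module.finrank_fintype_fun_eq_card] at hrn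
  rw [hker, ← hrn, add_comm]

theorem Matrix.linearIndependent_row_of_rank_eq_card {K m n : Type*} [Field K] [Fintype m]
    [Fintype n] {A : Matrix m n K} (h : A.rank = Fintype.card m) : LinearIndependent K A.row := by
  rw [linearIndependent_iff_card_eq_finrank_span, ← h]
  exact A.rank_eq_finrank_span_row

/-- A nonzero vector is the first member of a linearly independent family of any length up to the
dimension. -/
theorem exists_linearIndependent_fin_succ_of_ne_zero {K V : Type*} [Field K] [AddCommGroup V]
    [Module K V] {v : V} (hv : v ≠ 0) (m : ℕ) (hm : m + 1 ≤ Module.finrank K V) :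
    ∃ a : Fin (m + 1) → V, LinearIndependent K a ∧ a 0 = v := by
  induction m with
  | zero => exact ⟨fun _ => v, LinearIndependent.of_subsingleton (ι := Fin 1) 0 hv, rfl⟩
  | succ m ih =>
    obtain ⟨a, ha, ha0⟩ := ih (by lia)
    obtain ⟨x, hx⟩ := exists_linearIndependent_snoc_of_lt_finrank ha (by lia)
    refine ⟨Fin.snoc a x, hx, ?_⟩
    rw [← Fin.castSucc_zero, Fin.snoc_castSucc, ha0]

section IncidenceVariety

variable {n p m : ℕ} (F : Fin p → MvPolynomial (Fin n) ℚ)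

/-- The coordinates of the ambient space of `Hcone`. -/
abbrev HconeVar (n p m : ℕ) : Type := (Fin n ⊕ (Fin m × Fin n)) ⊕ (Fin p ⊕ Fin m)

/-- The defining equations of `Hcone` inside the locus where `a` has maximal rank and
`(λ, θ) ≠ 0`. -/
noncomputable def hconeEquation : Fin p ⊕ Fin n → MvPolynomial (HconeVar n p m) ℂ
  | Sum.inl k => rename (fun l => Sum.inl (Sum.inl l)) (map (algebraMap ℚ ℂ) (F k))
  | Sum.inr l =>
      (∑ k, X (Sum.inr (Sum.inl k)) * rename (fun l => Sum.inl (Sum.inl l))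
        (map (algebraMap ℚ ℂ) (pderiv l (F k)))) +
      ∑ k, X (Sum.inr (Sum.inr k)) * X (Sum.inl (Sum.inr (k, l)))

/-- The matrix with rows `a₁, …, a_m` at a point of the ambient space of `Hcone`. -/
def hconeMatrix (q : HconeVar n p m → ℂ) : Matrix (Fin m) (Fin n) ℂ :=
  Matrix.of fun k l => q (Sum.inl (Sum.inr (k, l)))

theorem aeval_rename_map_algebraMap {σ τ : Type*} (r : τ → σ) (f : MvPolynomial τ ℚ) (q : σ → ℂ) :
    aeval q (rename r (map (algebraMap ℚ ℂ) f)) = aeval (fun l => q (r l)) f := by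
  rw [aeval_rename, aeval_map_algebraMap]
  rfl

theorem aeval_hconeEquation_inl (q : HconeVar n p m → ℂ) (k : Fin p) :
    aeval q (hconeEquation F (Sum.inl k)) = aeval (fun l => q (Sum.inl (Sum.inl l))) (F k) :=
  aeval_rename_map_algebraMap _ _ _

theorem aeval_hconeEquation_inr (q : HconeVar n p m → ℂ) (l : Fin n) :
    aeval q (hconeEquation F (Sum.inr l)) =
      Matrix.vecMul (fun s => q (Sum.inr s))
        (Matrix.fromRows (jacC F fun l => q (Sum.inl (Sum.inl l))) (hconeMatrix q)) l := by
  rw [Matrix.vecMul_fromRows]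
  simp only [hconeEquation, map_add, map_sum, map_mul, aeval_X, aeval_rename_map_algebraMap]
  rfl

theorem aeval_hconeEquation_eq_zero {q : HconeVar n p m → ℂ} (hq : q ∈ Hcone F m)
    (j : Fin p ⊕ Fin n) : aeval q (hconeEquation F j) = 0 := by
  rcases j with k | l
  · rw [aeval_hconeEquation_inl]
    exact hq.1.1 k
  · rw [aeval_hconeEquation_inr]
    exact congrFun hq.2.2.2 l

theorem vecMul_jacC_injective {x : Fin n → ℂ} (hx : x ∈ SregC F) :
    Function.Injective fun v => Matrix.vecMul v (jacC F x) :=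
  Matrix.vecMul_injective_iff.mpr
    (Matrix.linearIndependent_row_of_rank_eq_card (by rw [hx.2, Fintype.card_fin]))

theorem exists_ne_zero_of_mem_Hcone {q : HconeVar n p m → ℂ} (hq : q ∈ Hcone F m) :
    ∃ k, q (Sum.inr (Sum.inr k)) ≠ 0 := by
  obtain ⟨hx, -, hne, heq⟩ := hq
  by_contra! h
  refine hne ?_
  rw [Matrix.vecMul_fromRows, show (fun s => q (Sum.inr s)) ∘ Sum.inr = 0 from funext h,
    Matrix.zero_vecMul, add_zero] at heq
  have := vecMul_jacC_injective F hx (heq.trans (Matrix.zero_vecMul _).symm)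
  funext s
  rcases s with k | k
  · exact congrFun this k
  · exact h k

theorem cutsOutAt_Hcone (hsmooth : SregC F = zeroSetC F) {q : HconeVar n p m → ℂ}
    (hq : q ∈ Hcone F m) : CutsOutAt (Hcone F m) (hconeEquation F) q := by
  obtain ⟨k₀, hk₀⟩ := exists_ne_zero_of_mem_Hcone F hq
  obtain ⟨b, hb⟩ : ∃ b : Matrix (Fin n) (Fin m) ℂ, hconeMatrix q * b = 1 := by
    rw [← Matrix.mulVec_surjective_iff_exists_right_inverse]
    have : LinearMap.range (hconeMatrix q).mulVecLin = ⊤ := by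
      refine Submodule.eq_top_of_finrank_eq ?_
      rw [Module.finrank_fintype_fun_eq_card, Fintype.card_fin]
      exact hq.2.1
    exact LinearMap.range_eq_top.mp this
  let D : Matrix (Fin m) (Fin m) (MvPolynomial (HconeVar n p m) ℂ) :=
    (Matrix.of fun k l => X (Sum.inl (Sum.inr (k, l)))) * b.map C
  have hD : ∀ x : HconeVar n p m → ℂ, aeval x D.det = (hconeMatrix x * b).det := by
    intro x
    rw [AlgHom.map_det]
    congr 1
    ext k l
    change aeval x (D k l) = _
    rw [show D k l = _ from Matrix.mul_apply, Matrix.mul_apply]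
    simp [hconeMatrix]
  refine ⟨X (Sum.inr (Sum.inr k₀)) * D.det, ?_, fun x hx hdx => ?_⟩
  · rw [map_mul, aeval_X, hD, hb, Matrix.det_one, mul_one]
    exact hk₀
  · rw [map_mul, aeval_X, hD, mul_ne_zero_iff] at hdx
    refine ⟨?_, ?_, fun h => hdx.1 (congrFun h (Sum.inr k₀)), ?_⟩
    · rw [hsmooth]
      exact fun k => (aeval_hconeEquation_inl F x k).symm.trans (hx _)
    · refine le_antisymm ((Matrix.rank_le_card_height _).trans_eq (Fintype.card_fin m)) ?_
      have h := Matrix.rank_of_isUnit _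
        ((Matrix.isUnit_iff_isUnit_det _).mpr (isUnit_iff_ne_zero.mpr hdx.2))
      rw [Fintype.card_fin] at h
      exact h.symm.le.trans (Matrix.rank_mul_le_left _ _)
    · funext l
      exact (aeval_hconeEquation_inr F x l).symm.trans (hx _)

theorem pderiv_rename_eq_zero {R σ τ : Type*} [CommSemiring R] {r : τ → σ} {j : σ}
    (hj : ∀ l, r l ≠ j) (f : MvPolynomial τ R) : pderiv j (rename r f) = 0 := by
  classical
  refine pderiv_eq_zero_of_notMem_vars fun h => ?_
  obtain ⟨l, -, hl⟩ := Finset.mem_image.mp (vars_rename r f h)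
  exact hj l hl

theorem linearIndependent_jacobianAt_hconeEquation {q : HconeVar n p m → ℂ}
    (hq : q ∈ Hcone F m) : LinearIndependent ℂ (jacobianAt (hconeEquation F) q).row := by
  obtain ⟨k₀, hk₀⟩ := exists_ne_zero_of_mem_Hcone F hq
  rw [Fintype.linearIndependent_iff]
  intro c hc
  have hcomp : ∀ v, ∑ j, c j * eval q (pderiv v (hconeEquation F j)) = 0 := fun v => by
    simpa [jacobianAt] using congrFun hc v
  have hr : ∀ l, c (Sum.inr l) = 0 := by
    intro l
    have h := hcomp (Sum.inl (Sum.inr (k₀, l)))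
    have hinl : ∀ f : MvPolynomial (Fin n) ℂ, pderiv (Sum.inl (Sum.inr (k₀, l)))
        (rename (fun l => (Sum.inl (Sum.inl l) : HconeVar n p m)) f) = 0 :=
      pderiv_rename_eq_zero (by simp)
    simp only [Fintype.sum_sum_type, hconeEquation, hinl] at h
    simpa [Derivation.leibniz, hinl, pderiv_X, Pi.single_apply, hk₀, Finset.sum_add_distrib,
      ite_and, Finset.mul_sum, apply_ite] using h
  have hl : c ∘ Sum.inl = 0 := by
    refine vecMul_jacC_injective F hq.1 (funext fun l => ?_)
    have h := hcomp (Sum.inl (Sum.inl l))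
    have hinj : Function.Injective fun l => (Sum.inl (Sum.inl l) : HconeVar n p m) :=
      Sum.inl_injective.comp Sum.inl_injective
    simp only [Fintype.sum_sum_type, hr, zero_mul, Finset.sum_const_zero, add_zero,
      hconeEquation] at h
    simp only [pderiv_rename hinj l, pderiv_map, ← aeval_eq_eval,
      aeval_rename_map_algebraMap] at h
    simpa [Matrix.vecMul, dotProduct, jacC] using h
  rintro (k | l)
  · exact congrFun hl k
  · exact hr l

theorem nonempty_Hcone (hp : 1 ≤ p) (hm : m + 1 ≤ n) (hne : (SregC F).Nonempty) :
    (Hcone F (m + 1)).Nonempty := by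
  obtain ⟨x, hx⟩ := hne
  let k₁ : Fin p := ⟨0, hp⟩
  have hJ : LinearIndependent ℂ (jacC F x).row :=
    Matrix.linearIndependent_row_of_rank_eq_card (by rw [hx.2, Fintype.card_fin])
  obtain ⟨a, ha, ha0⟩ := exists_linearIndependent_fin_succ_of_ne_zero (K := ℂ)
    (v := -(jacC F x).row k₁) (neg_ne_zero.mpr (hJ.ne_zero k₁)) m (by simpa using hm)
  refine ⟨Sum.elim (Sum.elim x fun kl => a kl.1 kl.2)
    (Sum.elim (Pi.single k₁ 1) (Pi.single 0 1)), hx, ?_, ?_, ?_⟩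
  · have : LinearIndependent ℂ (Matrix.of a).row := ha
    simpa using this.rank_matrix
  · intro h
    simpa using congrFun h (Sum.inr 0)
  · rw [Matrix.vecMul_fromRows]
    funext l
    have h1 : (Matrix.vecMul (Pi.single k₁ 1) (jacC F x)) l = (jacC F x).row k₁ l := by simp
    have h2 : (Matrix.vecMul (Pi.single 0 1) (Matrix.of a)) l = a 0 l := by simp
    rw [ha0] at h2
    change Matrix.vecMul (Pi.single k₁ 1) (jacC F x) l +
      Matrix.vecMul (Pi.single 0 1) (Matrix.of a) l = 0
    rw [h1, h2, Pi.neg_apply, add_neg_cancel]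

theorem isPureDim_Hcone (hpn : p ≤ n) (hdim : IsPureDim (zeroSetC F) (n - p))
    (hsmooth : SregC F = zeroSetC F) : IsPureDim (Hcone F m) (m * n + m) := by
  classical
  intro P hP
  have hPprime : P.IsPrime := hP.1.1
  obtain ⟨s, hs, -⟩ := exists_ringKrullDim_eq_and_trdeg_eq ℂ (MvPolynomial (HconeVar n p m) ℂ ⧸ P)
  obtain ⟨q, hqT, hqP, -⟩ := exists_mem_zeroLocus_of_mem_minimalPrimes hP
  obtain ⟨k₀, hk₀⟩ := exists_ne_zero_of_mem_Hcone F hqT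
  have hlower := card_le_ringKrullDim_add_card
    (fun x hx => aeval_hconeEquation_eq_zero F hx) (fun q hq => cutsOutAt_Hcone F hsmooth hq) hP
  let ρ : Fin n → HconeVar n p m := fun l => Sum.inl (Sum.inl l)
  let S : Finset (HconeVar n p m) :=
    ((∅ : Finset (Fin n)).disjSum ((Finset.univ.erase k₀) ×ˢ Finset.univ)).disjSum Finset.univ
  have hρS : ∀ f : MvPolynomial (Fin n) ℂ, rename ρ f ∈ supported ℂ (Set.range ρ ∪ S) := by
    intro f
    rw [mem_supported]
    intro j hj
    obtain ⟨l, -, rfl⟩ := Finset.mem_image.mp (vars_rename ρ f hj)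
    exact Or.inl ⟨l, rfl⟩
  have hS : ∀ j, j ∈ Set.range ρ ∪ (S : Set (HconeVar n p m)) ∨
      ∃ l, j = Sum.inl (Sum.inr (k₀, l)) := by
    rintro ((l | ⟨k, l⟩) | s)
    · exact Or.inl (Or.inl ⟨l, rfl⟩)
    · by_cases hk : k = k₀
      · exact Or.inr ⟨l, by rw [hk]⟩
      · exact Or.inl (Or.inr (by simp [S, hk]))
    · exact Or.inl (Or.inr (by simp [S]))
  have hXS : ∀ s, X (Sum.inr s) ∈ supported ℂ (Set.range ρ ∪ (S : Set (HconeVar n p m))) :=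
    fun s => X_mem_supported.mpr (Or.inr (by simp [S]))
  have hupper := ringKrullDim_quotient_le_comap_rename_add_card P ρ S fun j => by
    rcases hS j with hj | ⟨l, rfl⟩
    · exact ⟨1, one_mem _, P.ne_top_iff_one.mp hPprime.ne_top, X j, X_mem_supported.mpr hj,
        by simp⟩
    · refine ⟨X (Sum.inr (Sum.inr k₀)), hXS _, fun h => hk₀ (by simpa using hqP _ h),
        -((∑ k, X (Sum.inr (Sum.inl k)) * rename ρ (map (algebraMap ℚ ℂ) (pderiv l (F k)))) +
          ∑ k ∈ Finset.univ.erase k₀, X (Sum.inr (Sum.inr k)) * X (Sum.inl (Sum.inr (k, l)))),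
        ?_, ?_⟩
      · refine neg_mem (add_mem (sum_mem fun k _ => mul_mem (hXS _) (hρS _))
          (sum_mem fun k hk => mul_mem (hXS _) (X_mem_supported.mpr (Or.inr ?_))))
        simpa [S] using hk
      · refine hP.1.2 fun x hx => ?_
        rw [← aeval_hconeEquation_eq_zero F hx (Sum.inr l)]
        congr 1
        rw [hconeEquation, ← Finset.add_sum_erase _ _ (Finset.mem_univ k₀)]
        ring
  have hbase : ringKrullDim (MvPolynomial (Fin n) ℂ ⧸ P.comap (rename (R := ℂ) ρ)) ≤
      (n - p : ℕ) := by
    have hle : vanishingIdeal ℂ (zeroSetC F) ≤ P.comap (rename (R := ℂ) ρ) := fun f hf =>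
      hP.1.2 fun x hx => by
        exact (aeval_rename ρ x f).trans (hf _ hx.1.1)
    obtain ⟨P₁, hP₁, hP₁le⟩ := Ideal.exists_minimalPrimes_le hle
    exact (ringKrullDim_le_of_surjective (Ideal.Quotient.factor hP₁le)
      (Ideal.Quotient.factor_surjective hP₁le)).trans (hdim P₁ hP₁).le
  have hcard : S.card = (m - 1) * n + (p + m) := by
    simp [S, Finset.card_disjSum]
  have hupper := hupper.trans (add_le_add_left hbase _)
  rw [hs, hcard] at hupper
  rw [hs] at hlower
  have hupper : s ≤ n - p + ((m - 1) * n + (p + m)) := by exact_mod_cast hupper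
  have hlower : n + m * n + (p + m) ≤ s + (p + n) := by
    have : Nat.card (HconeVar n p m) ≤ s + Nat.card (Fin p ⊕ Fin n) := by exact_mod_cast hlower
    simpa using this
  have hmn : (m - 1) * n + n = m * n := by
    obtain ⟨m, rfl⟩ : ∃ m', m = m' + 1 := ⟨m - 1, by have := k₀.pos; lia⟩
    simp [add_mul]
  rw [hs]
  congr 1
  have : s = m * n + m := by lia
  rw [this]

end IncidenceVariety

/-- Section 3.2 of the paper. Suppose `S` is smooth and
`1 ≤ i ≤ n-p`. Then the incidence variety `𝓗_i` is nonempty, smooth and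
equidimensional of dimension `n-p-i+(n-p-i+1)n`; equivalently, its affine cone (adding
one to the dimension for the projective factor) is nonempty, of pure dimension
`n-p-i+(n-p-i+1)n + 1` and smooth at each of its points. -/
theorem statement8 {n p i : ℕ} (hp1 : 1 ≤ p) (hpn : p ≤ n)
    (hi1 : 1 ≤ i) (hi2 : i ≤ n - p)
    (F : Fin p → MvPolynomial (Fin n) ℚ)
    (hreg : IsRegSeq (List.ofFn F))
    (hrad : idealOfDef F)
    (hSne : (zeroSetC F).Nonempty)
    (hSdim : IsPureDim (zeroSetC F) (n - p))
    (hsmooth : SregC F = zeroSetC F) :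
    (Hcone F (n - p - i + 1)).Nonempty ∧
    IsPureDim (Hcone F (n - p - i + 1)) (n - p - i + (n - p - i + 1) * n + 1) ∧
    ∀ q ∈ Hcone F (n - p - i + 1),
      Module.finrank ℂ ↥(tangentAt (Hcone F (n - p - i + 1)) q) =
        n - p - i + (n - p - i + 1) * n + 1 := by
  have hdim : n - p - i + (n - p - i + 1) * n + 1 =
      (n - p - i + 1) * n + (n - p - i + 1) := by ring
  refine ⟨nonempty_Hcone F hp1 (by lia) (hsmooth ▸ hSne), ?_, fun q hq => ?_⟩
  · rw [hdim]
    exact isPureDim_Hcone F hpn hSdim hsmooth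
  · have h := finrank_tangentAt_add_card (fun x hx => aeval_hconeEquation_eq_zero F hx) hq
      (cutsOutAt_Hcone F hsmooth hq) (linearIndependent_jacobianAt_hconeEquation F hq)
    simp only [Fintype.card_sum, Fintype.card_prod, Fintype.card_fin] at h
    lia
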